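/- arXiv:2212.03941 — 4 statements merged into one kernel-verified Lean document; each statement's English description precedes it below -/
import Mathlib

section
/- Let F be a finite field of characteristic p ≥ 5 and cardinality q. Let E : y² = x³ + ax + b and E' : y² = x³ + a'x + b' be elliptic curves over F (so 4a³ + 27b² ≠ 0 and 4a'³ + 27b'² ≠ 0), and let P = (λ, μ) ∈ E(F) and P' = (λ', μ') ∈ E'(F) be affine points. Then the groups G_{E,P}(F) and G_{E',P'}(F) are isomorphic if and only if there exist σ ∈ Gal(F/F_p) and u ∈ F^× such that σ(a) = u⁴a', σ(b) = u⁶b', σ(λ) = u²λ', and σ(μ) = u³μ' (that is, there is an isomorphism of elliptic curves E' → σ(E) sending P' to σ(P)). -/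
open Matrix

/-- The Baer multiplication on `V × T` associated with a bilinear map `t`:
`(v,w)·(v',w') = (v + v', w + w' + (1/2)·t(v,v'))`. -/
def baerMul {K V T : Type*} [Field K] [AddCommGroup V] [Module K V]
    [AddCommGroup T] [Module K T] (t : V → V → T) (x y : V × T) : V × T :=
  (x.1 + y.1, x.2 + y.2 + (2 : K)⁻¹ • t x.1 y.1)

/-- The tensor `(u, v) ↦ (uᵀ B₁ v, …, uᵀ B_d v)` given coefficient matrices `B₁, …, B_d`. -/
def matTensor {K : Type*} [CommRing K] {ι : Type*} [Fintype ι] {d : ℕ}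
    (B : Fin d → Matrix ι ι K) (u v : ι → K) : Fin d → K :=
  fun k => u ⬝ᵥ (B k).mulVec v

/-- The coefficient matrices of the matrix of linear forms `J_{E,P}` (with respect to the
variables `x, y, z`), where `E : y² = x³ + ax + b` and `P = (λ, μ)`:
`J_{E,P}` has rows `(x − λz, y − μz, 0)`, `(y + μz, λx + (a+λ²)z, x)`, `(0, x, −z)`. -/
def Jmat {K : Type*} [CommRing K] (a lam mu : K) : Fin 3 → Matrix (Fin 3) (Fin 3) K :=
  ![!![1, 0, 0; 0, lam, 1; 0, 1, 0],
    !![0, 1, 0; 1, 0, 0; 0, 0, 0],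
    !![-lam, -mu, 0; mu, a + lam ^ 2, 0; 0, 0, -1]]

/-- Coefficient matrices of the skew-symmetric matrix of linear forms
`B_{E,P} = [[0, J_{E,P}], [−J_{E,P}ᵀ, 0]] ∈ Mat₆(K[x,y,z]₁)` (rows and columns indexed by
`Fin 3 ⊕ Fin 3`). -/
def BmatEP {K : Type*} [CommRing K] (a lam mu : K) :
    Fin 3 → Matrix (Fin 3 ⊕ Fin 3) (Fin 3 ⊕ Fin 3) K :=
  fun k => Matrix.fromBlocks 0 (Jmat a lam mu k) (-(Jmat a lam mu k)ᵀ) 0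

/-- The alternating tensor `K⁶ × K⁶ → K³` represented by `B_{E,P}`. -/
def epTensor {K : Type*} [CommRing K] (a lam mu : K) :
    ((Fin 3 ⊕ Fin 3) → K) → ((Fin 3 ⊕ Fin 3) → K) → (Fin 3 → K) :=
  matTensor (BmatEP a lam mu)

open scoped Kronecker

section Invariants

variable {S : Type*} [CommRing S] {ι : Type*} [Fintype ι]

/-- The matrix of the cross product with `v`. -/
def crossMat (v : Fin 3 → S) : Matrix (Fin 3) (Fin 3) S :=
  !![0, -v 2, v 1; v 2, 0, -v 0; -v 1, v 0, 0]

theorem transpose_mul_crossMat_mul (Y : Matrix (Fin 3) (Fin 3) S) (v : Fin 3 → S) :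
    Yᵀ * crossMat (Y *ᵥ v) * Y = Y.det • crossMat v := by
  ext i j
  fin_cases i <;> fin_cases j <;>
    simp [crossMat, Matrix.mul_apply, Fin.sum_univ_three, Matrix.mulVec, dotProduct,
      Matrix.det_fin_three] <;> ring

theorem crossMat_eq_sum (v : Fin 3 → S) :
    crossMat v = ∑ k, v k • crossMat (Pi.single k 1) := by
  ext i j
  fin_cases i <;> fin_cases j <;> simp [crossMat, Fin.sum_univ_three]

/-- The Koszul flattening of a triple of matrices. -/
def koszul (B : Fin 3 → Matrix ι ι S) : Matrix (ι × Fin 3) (ι × Fin 3) S :=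
  ∑ k, B k ⊗ₖ crossMat (Pi.single k 1)

theorem koszul_transform {B B' : Fin 3 → Matrix ι ι S} {W₁ W₂ : Matrix ι ι S}
    {Y : Matrix (Fin 3) (Fin 3) S} (h : ∀ k, W₁ * B' k * W₂ = ∑ l, Y k l • B l) :
    (W₁ ⊗ₖ Yᵀ) * koszul B' * (W₂ ⊗ₖ Y) = Y.det • koszul B := by
  have hcol (l : Fin 3) : ∑ k, Y k l • (Yᵀ * crossMat (Pi.single k 1) * Y) =
      Y.det • crossMat (Pi.single l 1) := by
    rw [← transpose_mul_crossMat_mul, crossMat_eq_sum (Y *ᵥ _)]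
    simp [Finset.mul_sum, Finset.sum_mul]
  simp only [koszul, Finset.mul_sum, Finset.sum_mul, ← mul_kronecker_mul, h, Finset.smul_sum]
  have hk (k : Fin 3) : (∑ l, Y k l • B l) ⊗ₖ (Yᵀ * crossMat (Pi.single k 1) * Y) =
      ∑ l, B l ⊗ₖ (Y k l • (Yᵀ * crossMat (Pi.single k 1) * Y)) := by
    ext ⟨i, j⟩ ⟨i', j'⟩
    simp only [kronecker_apply, Matrix.sum_apply, Matrix.smul_apply, Finset.sum_mul, smul_eq_mul]
    exact Finset.sum_congr rfl fun _ _ => by ring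
  simp only [hk]
  rw [Finset.sum_comm]
  refine Finset.sum_congr rfl fun l _ => ?_
  rw [← kronecker_smul, ← hcol l]
  ext ⟨i, j⟩ ⟨i', j'⟩
  simp only [kronecker_apply, Matrix.sum_apply, Finset.mul_sum]

theorem trace_pow_eq_of_intertwine [DecidableEq ι] {A B Z : Matrix ι ι S} (hZ : IsUnit Z)
    (h : A * Z = Z * B) (n : ℕ) : trace (A ^ n) = trace (B ^ n) := by
  obtain ⟨Z, rfl⟩ := hZ
  have hA : A = Z * B * (Z⁻¹ : (Matrix ι ι S)ˣ) := by
    rw [← h, mul_assoc, Units.mul_inv, mul_one]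
  rw [hA, Units.conj_pow, trace_units_conj]

end Invariants

section Covariants

variable {S : Type*} [CommRing S]

/-- The alternating matrix with off-diagonal blocks `J` and `-Jᵀ`. -/
def skewBlock (J : Matrix (Fin 3) (Fin 3) S) : Matrix (Fin 3 ⊕ Fin 3) (Fin 3 ⊕ Fin 3) S :=
  fromBlocks 0 J (-Jᵀ) 0

/-- `coskewBlock J.adjugate` is the Pfaffian adjoint of `skewBlock J`. -/
def coskewBlock (J : Matrix (Fin 3) (Fin 3) S) : Matrix (Fin 3 ⊕ Fin 3) (Fin 3 ⊕ Fin 3) S :=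
  fromBlocks 0 (-Jᵀ) J 0

theorem coskewBlock_add (A B : Matrix (Fin 3) (Fin 3) S) :
    coskewBlock (A + B) = coskewBlock A + coskewBlock B := by
  simp [coskewBlock, fromBlocks_add, add_comm]

theorem coskewBlock_smul (c : S) (A : Matrix (Fin 3) (Fin 3) S) :
    coskewBlock (c • A) = c • coskewBlock A := by
  simp [coskewBlock, fromBlocks_smul]

theorem coskewBlock_sum {κ : Type*} (s : Finset κ) (A : κ → Matrix (Fin 3) (Fin 3) S) :
    coskewBlock (∑ k ∈ s, A k) = ∑ k ∈ s, coskewBlock (A k) :=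
  map_sum (⟨⟨coskewBlock, by simp [coskewBlock]⟩, coskewBlock_add⟩ :
    Matrix (Fin 3) (Fin 3) S →+ Matrix (Fin 3 ⊕ Fin 3) (Fin 3 ⊕ Fin 3) S) A s

theorem skewBlock_mul_coskewBlock_adjugate (J : Matrix (Fin 3) (Fin 3) S) :
    skewBlock J * coskewBlock J.adjugate = J.det • 1 := by
  simp [skewBlock, coskewBlock, fromBlocks_multiply, mul_adjugate, ← transpose_mul,
    adjugate_mul, ← fromBlocks_one, fromBlocks_smul]

theorem det_skewBlock (J : Matrix (Fin 3) (Fin 3) S) : (skewBlock J).det = J.det ^ 2 := by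
  have h : fromBlocks (1 : Matrix (Fin 3) (Fin 3) S) 0 1 1 * fromBlocks 1 (-1) 0 1 *
      fromBlocks 1 0 1 1 * skewBlock J = fromBlocks Jᵀ 0 0 J := by
    simp [skewBlock, fromBlocks_multiply]
  have := congrArg det h
  simp only [det_mul, det_fromBlocks_zero₂₁, det_fromBlocks_zero₁₂, det_one, det_transpose] at this
  linear_combination this

/-- The polarization of the adjugate of `3 × 3` matrices. -/
def adjPolar (A B : Matrix (Fin 3) (Fin 3) S) : Matrix (Fin 3) (Fin 3) S :=
  (A + B).adjugate - A.adjugate - B.adjugate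

theorem adjPolar_apply (A B : Matrix (Fin 3) (Fin 3) S) (i j : Fin 3) :
    adjPolar A B i j = A (j + 1) (i + 1) * B (j + 2) (i + 2) + B (j + 1) (i + 1) * A (j + 2) (i + 2)
      - A (j + 1) (i + 2) * B (j + 2) (i + 1) - B (j + 1) (i + 2) * A (j + 2) (i + 1) := by
  fin_cases i <;> fin_cases j <;> simp [adjPolar, adjugate_fin_three] <;> ring

theorem adjPolar_comm (A B : Matrix (Fin 3) (Fin 3) S) : adjPolar A B = adjPolar B A := by
  ext i j; simp only [adjPolar_apply]; ring

theorem adjPolar_sum_smul (y : Fin 3 → S) (J : Fin 3 → Matrix (Fin 3) (Fin 3) S)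
    (B : Matrix (Fin 3) (Fin 3) S) :
    adjPolar (∑ k, y k • J k) B = ∑ k, y k • adjPolar (J k) B := by
  ext i j
  simp only [adjPolar_apply, Fin.sum_univ_three, Matrix.add_apply, Matrix.smul_apply, smul_eq_mul]
  ring

end Covariants

section Transformation

variable {R : Type*} [CommRing R] [IsDomain R]

theorem coskewBlock_transform_of_det {J J' : Matrix (Fin 3) (Fin 3) R}
    {X : Matrix (Fin 3 ⊕ Fin 3) (Fin 3 ⊕ Fin 3) R} (h : Xᵀ * skewBlock J' * X = skewBlock J)
    {c : R} (hc : J.det = c * J'.det) (hJ : J.det ≠ 0) :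
    c • coskewBlock J'.adjugate = X * coskewBlock J.adjugate * Xᵀ := by
  have hdet : (Xᵀ * skewBlock J').det ≠ 0 := by
    have h2 : (Xᵀ * skewBlock J').det * X.det = J.det ^ 2 := by
      rw [← det_mul, h, det_skewBlock]
    exact left_ne_zero_of_mul (h2 ▸ pow_ne_zero 2 hJ)
  have key : (Xᵀ * skewBlock J') *
      (c • coskewBlock J'.adjugate - X * coskewBlock J.adjugate * Xᵀ) = 0 := by
    rw [mul_sub, mul_smul_comm, mul_assoc, skewBlock_mul_coskewBlock_adjugate,
      show Xᵀ * skewBlock J' * (X * coskewBlock J.adjugate * Xᵀ) =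
        (Xᵀ * skewBlock J' * X) * coskewBlock J.adjugate * Xᵀ by simp only [mul_assoc],
      h, skewBlock_mul_coskewBlock_adjugate, hc]
    simp [smul_smul]
  have h3 := congrArg ((Xᵀ * skewBlock J').adjugate * ·) key
  simp only [mul_zero] at h3
  rw [← mul_assoc _ (Xᵀ * skewBlock J'), adjugate_mul, smul_mul_assoc, one_mul] at h3
  exact sub_eq_zero.mp ((smul_eq_zero.mp h3).resolve_left hdet)

end Transformation

section Pencil

variable {F : Type*} [Field F]

theorem map_coskewBlock {S T : Type*} [CommRing S] [CommRing T] (φ : S →+* T)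
    (J : Matrix (Fin 3) (Fin 3) S) :
    (coskewBlock J.adjugate).map φ = coskewBlock (J.map φ).adjugate := by
  have h : (J.map φ).adjugate = J.adjugate.map φ := (RingHom.map_adjugate φ J).symm
  rw [h]
  simp [coskewBlock, fromBlocks_map, transpose_map, Matrix.map_neg]

theorem skewBlock_sum_smul {S : Type*} [CommRing S] (y : Fin 3 → S)
    (J : Fin 3 → Matrix (Fin 3) (Fin 3) S) :
    skewBlock (∑ k, y k • J k) = ∑ k, y k • skewBlock (J k) := by
  ext i j
  rcases i with i | i <;> rcases j with j | j <;>
    simp [skewBlock, Fin.sum_univ_three, Matrix.add_apply]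
  ring

/-- A congruence between two alternating pencils induces a congruence between the Pfaffian adjoints,
up to a constant whose square is the squared determinant of the congruence. -/
theorem exists_coskewBlock_transform {J J' : Fin 3 → Matrix (Fin 3) (Fin 3) F}
    {X : Matrix (Fin 3 ⊕ Fin 3) (Fin 3 ⊕ Fin 3) F} {Y : Matrix (Fin 3) (Fin 3) F}
    (h : ∀ k, Xᵀ * skewBlock (J' k) * X = ∑ l, Y k l • skewBlock (J l))
    (hY : IsUnit Y.det) (hJ : (J 0).det ≠ 0) :
    ∃ c : F, c ^ 2 = X.det ^ 2 ∧ ∀ y : Fin 3 → F,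
      c • coskewBlock (∑ k, y k • J' k).adjugate =
        X * coskewBlock (∑ l, (y ᵥ* Y) l • J l).adjugate * Xᵀ := by
  let φ : F →+* MvPolynomial (Fin 3) F := MvPolynomial.C
  let G' : Matrix (Fin 3) (Fin 3) (MvPolynomial (Fin 3) F) :=
    ∑ k, (MvPolynomial.X k : MvPolynomial (Fin 3) F) • (J' k).map φ
  let G : Matrix (Fin 3) (Fin 3) (MvPolynomial (Fin 3) F) :=
    ∑ l, ((MvPolynomial.X : Fin 3 → MvPolynomial (Fin 3) F) ᵥ* Y.map φ) l • (J l).map φ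
  have evalG' (y : Fin 3 → F) : G'.map (MvPolynomial.eval y) = ∑ k, y k • J' k := by
    ext i j
    simp [G', φ, Matrix.sum_apply]
  have evalG (y : Fin 3 → F) : G.map (MvPolynomial.eval y) = ∑ l, (y ᵥ* Y) l • J l := by
    ext i j
    simp [G, φ, Matrix.sum_apply, Matrix.vecMul, dotProduct]
  have map_skew (K : Matrix (Fin 3) (Fin 3) F) :
      skewBlock (K.map φ) = (skewBlock K).map φ := by
    simp [skewBlock, fromBlocks_map, transpose_map, Matrix.map_neg]
  have hX : (X.map φ)ᵀ * skewBlock G' * X.map φ = skewBlock G := by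
    have hk (k : Fin 3) : (X.map φ)ᵀ * skewBlock ((J' k).map φ) * X.map φ =
        ∑ l, φ (Y k l) • skewBlock ((J l).map φ) := by
      have := congrArg (fun M => M.map φ) (h k)
      simp only [Matrix.map_mul, transpose_map] at this
      rw [map_skew, this]
      ext i j
      simp [Matrix.sum_apply, map_skew]
    simp only [G', G, skewBlock_sum_smul]
    simp only [Finset.mul_sum, Finset.sum_mul, mul_smul_comm,
      smul_mul_assoc, hk, Finset.smul_sum, smul_smul, Matrix.vecMul, dotProduct, Finset.sum_smul,
      Matrix.map_apply]
    exact Finset.sum_comm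
  have hG : G.det ≠ 0 := by
    intro h0
    have h1 : (G.map (MvPolynomial.eval (Pi.single 0 1 ᵥ* Y⁻¹))).det = 0 := by
      have := RingHom.map_det (MvPolynomial.eval (Pi.single 0 1 ᵥ* Y⁻¹)) G
      rw [h0, map_zero] at this
      exact this.symm
    rw [evalG, vecMul_vecMul, nonsing_inv_mul _ hY, vecMul_one] at h1
    apply hJ
    simpa [Fin.sum_univ_three] using h1
  have hsq : G.det ^ 2 = (φ X.det * G'.det) ^ 2 := by
    have h1 := congrArg det hX
    rw [det_mul, det_mul, det_transpose, det_skewBlock, det_skewBlock] at h1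
    have h2 : (X.map φ).det = φ X.det := (RingHom.map_det φ X).symm
    rw [h2] at h1
    linear_combination -h1
  obtain ⟨c, hc2, hc⟩ : ∃ c : F, c ^ 2 = X.det ^ 2 ∧ G.det = φ c * G'.det := by
    rcases sq_eq_sq_iff_eq_or_eq_neg.mp hsq with h | h
    · exact ⟨X.det, rfl, h⟩
    · exact ⟨-X.det, by ring, by rw [h, map_neg, neg_mul]⟩
  refine ⟨c, hc2, fun y => ?_⟩
  have h3 := congrArg (fun M => M.map (MvPolynomial.eval y))
    (coskewBlock_transform_of_det hX hc hG)
  have hXe : (X.map φ).map (MvPolynomial.eval y) = X := by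
    ext i j
    simp [φ]
  simp only [Matrix.map_mul, map_coskewBlock, transpose_map, evalG, hXe] at h3
  rw [← h3, ← evalG', ← map_coskewBlock]
  ext i j
  simp [φ]

theorem exists_adjPolar_transform {J J' : Fin 3 → Matrix (Fin 3) (Fin 3) F}
    {X : Matrix (Fin 3 ⊕ Fin 3) (Fin 3 ⊕ Fin 3) F} {Y : Matrix (Fin 3) (Fin 3) F}
    (h : ∀ k, Xᵀ * skewBlock (J' k) * X = ∑ l, Y k l • skewBlock (J l))
    (hY : IsUnit Y.det) (hJ : (J 0).det ≠ 0) :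
    ∃ c : F, c ^ 2 = X.det ^ 2 ∧ ∀ k l, c • coskewBlock (adjPolar (J' k) (J' l)) =
      ∑ p, ∑ q, (Y k p * Y l q) • (X * coskewBlock (adjPolar (J p) (J q)) * Xᵀ) := by
  obtain ⟨c, hc, hQ⟩ := exists_coskewBlock_transform h hY hJ
  refine ⟨c, hc, fun k l => ?_⟩
  have hsub (A B : Matrix (Fin 3) (Fin 3) F) :
      coskewBlock (adjPolar A B) = coskewBlock (A + B).adjugate - coskewBlock A.adjugate -
        coskewBlock B.adjugate := by
    rw [eq_sub_iff_add_eq, eq_sub_iff_add_eq, ← coskewBlock_add, ← coskewBlock_add, adjPolar]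
    congr 1
    abel
  have h1 := hQ (Pi.single k 1)
  have h2 := hQ (Pi.single l 1)
  have h3 := hQ (Pi.single k 1 + Pi.single l 1)
  have e (k : Fin 3) : ∑ m, (Pi.single k 1 : Fin 3 → F) m • J' m = J' k := by
    simp [Pi.single_apply]
  have e2 : ∑ m, (Pi.single k 1 + Pi.single l 1 : Fin 3 → F) m • J' m = J' k + J' l := by
    simp only [Pi.add_apply, add_smul, Finset.sum_add_distrib, e]
  have e3 : ∑ m, ((Pi.single k 1 + Pi.single l 1 : Fin 3 → F) ᵥ* Y) m • J m =
      ∑ m, Y k m • J m + ∑ m, Y l m • J m := by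
    simp only [add_vecMul, single_one_vecMul, Pi.add_apply, add_smul, Finset.sum_add_distrib,
      Matrix.row]
  rw [e2, e3] at h3
  simp only [e, single_one_vecMul, Matrix.row] at h1 h2
  have h4 : c • coskewBlock (adjPolar (J' k) (J' l)) =
      X * coskewBlock (adjPolar (∑ m, Y k m • J m) (∑ m, Y l m • J m)) * Xᵀ := by
    rw [hsub, hsub, smul_sub, smul_sub, h1, h2, h3]
    simp only [mul_sub, sub_mul]
  rw [h4, adjPolar_sum_smul]
  simp only [adjPolar_comm _ (∑ m, Y l m • J m), adjPolar_sum_smul, coskewBlock_sum,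
    coskewBlock_smul, Finset.mul_sum, Finset.sum_mul, Finset.smul_sum, mul_smul_comm,
    smul_mul_assoc, smul_smul]
  simp only [adjPolar_comm]

end Pencil

section ExplicitInvariants

variable {S : Type*} [CommRing S]

/-- The polarized adjugate of a pencil of `3 × 3` matrices, as a single matrix. -/
def adjFlat (J : Fin 3 → Matrix (Fin 3) (Fin 3) S) :
    Matrix (Fin 3 × Fin 3) (Fin 3 × Fin 3) S :=
  of fun x y => adjPolar (J x.2) (J y.2) x.1 y.1

/-- The polarized Pfaffian adjoint of an alternating pencil, as a single matrix. -/
def pfaffFlat (J : Fin 3 → Matrix (Fin 3) (Fin 3) S) :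
    Matrix ((Fin 3 ⊕ Fin 3) × Fin 3) ((Fin 3 ⊕ Fin 3) × Fin 3) S :=
  of fun x y => coskewBlock (adjPolar (J x.2) (J y.2)) x.1 y.1

theorem pfaffFlat_submatrix (J : Fin 3 → Matrix (Fin 3) (Fin 3) S) :
    (pfaffFlat J).submatrix (Equiv.sumProdDistrib _ _ _).symm (Equiv.sumProdDistrib _ _ _).symm =
      fromBlocks 0 (-(adjFlat J)ᵀ) (adjFlat J) 0 := by
  ext i j
  rcases i with ⟨i, k⟩ | ⟨i, k⟩ <;> rcases j with ⟨j, l⟩ | ⟨j, l⟩ <;>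
    simp [pfaffFlat, adjFlat, coskewBlock]
  rw [adjPolar_comm]

theorem crossMat_swap (v : Fin 3 → S) (i j : Fin 3) : crossMat v i j = -crossMat v j i := by
  fin_cases i <;> fin_cases j <;> simp [crossMat]

theorem koszul_skewBlock_submatrix (J : Fin 3 → Matrix (Fin 3) (Fin 3) S) :
    (koszul fun k => skewBlock (J k)).submatrix (Equiv.sumProdDistrib _ _ _).symm
        (Equiv.sumProdDistrib _ _ _).symm =
      fromBlocks 0 (koszul J) (koszul J)ᵀ 0 := by
  ext i j
  rcases i with ⟨i, k⟩ | ⟨i, k⟩ <;> rcases j with ⟨j, l⟩ | ⟨j, l⟩ <;>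
    simp [koszul, skewBlock, Matrix.sum_apply]
  rw [← Finset.sum_neg_distrib]
  refine Finset.sum_congr rfl fun n _ => ?_
  rw [crossMat_swap _ l k]
  ring

theorem trace_fromBlocks_eq {m n : Type*} [Fintype m] [Fintype n] (A : Matrix m m S)
    (B : Matrix m n S) (C : Matrix n m S) (D : Matrix n n S) :
    trace (fromBlocks A B C D) = trace A + trace D := by
  simp [trace]

theorem trace_pfaffFlat_mul_koszul_sq (J : Fin 3 → Matrix (Fin 3) (Fin 3) S) :
    trace ((pfaffFlat J * koszul fun k => skewBlock (J k)) ^ 2) =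
      2 * trace ((adjFlat J * koszul J) ^ 2) := by
  have htr {m n : Type _} [Fintype m] [Fintype n] (e : n ≃ m) (A : Matrix m m S) :
      trace (A.submatrix e e) = trace A := by
    simp only [trace, diag_apply, submatrix_apply]
    exact e.sum_comp fun i => A i i
  rw [← htr (Equiv.sumProdDistrib _ _ _).symm, sq, ← submatrix_mul_equiv _ _ _
    (Equiv.sumProdDistrib _ _ _).symm, ← submatrix_mul_equiv _ _ _
    (Equiv.sumProdDistrib _ _ _).symm, pfaffFlat_submatrix, koszul_skewBlock_submatrix]
  simp only [fromBlocks_multiply, zero_mul, mul_zero, add_zero, zero_add, trace_fromBlocks_eq,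
    neg_mul, mul_neg, neg_neg, ← transpose_mul, trace_transpose]
  rw [two_mul, sq]
  congr 1
  rw [← mul_assoc, trace_mul_comm]
  simp only [mul_assoc]

/-- The polarization of the Pfaffian of an alternating pencil, up to a scalar. -/
def cubicTensor (J : Fin 3 → Matrix (Fin 3) (Fin 3) S) (m : Fin 3) : Matrix (Fin 3) (Fin 3) S :=
  of fun k l => trace (coskewBlock (adjPolar (J k) (J l)) * skewBlock (J m))

/-- The endomorphism of the space of `3 × 3` matrices contracting with `cubicTensor`. -/
def cubicEnd (J : Fin 3 → Matrix (Fin 3) (Fin 3) S) : Matrix (Fin 3 × Fin 3) (Fin 3 × Fin 3) S :=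
  (koszul (cubicTensor J)).submatrix Prod.swap id

theorem cubicTensor_apply (J : Fin 3 → Matrix (Fin 3) (Fin 3) S) (m k l : Fin 3) :
    cubicTensor J m k l = 2 * trace (adjPolar (J k) (J l) * J m) := by
  simp only [cubicTensor, coskewBlock, skewBlock, of_apply, fromBlocks_multiply, trace_fromBlocks_eq]
  simp only [mul_zero, add_zero, zero_add, neg_mul, mul_neg, neg_neg, ← transpose_mul,
    trace_transpose, two_mul, trace_mul_comm (J m)]

theorem koszul_apply (B : Fin 3 → Matrix (Fin 3) (Fin 3) S) (x y : Fin 3 × Fin 3) :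
    koszul B x y = crossMat (fun k => B k x.1 y.1) x.2 y.2 := by
  rw [crossMat_eq_sum]
  simp [koszul, Matrix.sum_apply]

set_option maxHeartbeats 1000000 in
theorem adjFlat_mul_koszul_Jmat (a lam mu : S) :
    adjFlat (Jmat a lam mu) * koszul (Jmat a lam mu) =
      submatrix !![0, -3 * lam, 0, lam, -3 * mu, -3, -1, 0, 0;
      -1, 0, 0, 0, lam, 0, 0, 2, 0;
      3 * mu, -3 * lam ^ 2 - 2 * a, 0, 3 * lam ^ 2 + 3 * a, -3 * lam * mu, -2 * lam, 0, -3 * mu, -1;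
      1, 0, 0, 0, 0, 0, 0, -3, 0;
      0, 1, 0, -1, 0, 0, 0, 0, 0;
      -3 * lam, 3 * mu, -2, -3 * mu, 3 * lam ^ 2 + a, 0, 0, 3 * lam, 0;
      -2 * lam, 3 * mu, -3, -2 * mu, 3 * lam ^ 2 + 3 * a, 0, 0, 3 * lam, 0;
      0, lam, 0, 0, mu, 3, 2, 0, 0;
      0, 0, lam, 0, 3 * mu ^ 2 - 3 * lam ^ 3 - 3 * a * lam, mu, 0, a, 0]
        finProdFinEquiv finProdFinEquiv := by
  ext ⟨i, k⟩ ⟨j, l⟩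
  simp only [Matrix.mul_apply, adjFlat, koszul_apply, of_apply, adjPolar_apply, submatrix_apply,
    Fintype.sum_prod_type, Fin.sum_univ_three]
  fin_cases i <;> fin_cases j <;> fin_cases k <;> fin_cases l <;>
    simp [crossMat, Jmat, finProdFinEquiv] <;> ring

theorem trace_submatrix_equiv_sq {m n : Type*} [Fintype m] [Fintype n] (e : m ≃ n)
    (A : Matrix n n S) : trace (A.submatrix e e * A.submatrix e e) = trace (A * A) := by
  rw [submatrix_mul_equiv]
  exact e.sum_comp fun i => (A * A) i i

theorem trace_adjFlat_mul_koszul_sq_Jmat (a lam mu : S) :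
    trace ((adjFlat (Jmat a lam mu) * koszul (Jmat a lam mu)) ^ 2) = 72 * lam := by
  rw [sq, adjFlat_mul_koszul_Jmat, trace_submatrix_equiv_sq]
  simp [trace, Fin.sum_univ_succ]
  ring

theorem cubicTensor_Jmat (a lam mu b : S) (h : mu ^ 2 = lam ^ 3 + a * lam + b) :
    cubicTensor (Jmat a lam mu) =
      ![!![-12, 0, 0; 0, 0, 0; 0, 0, -4 * a], !![0, 0, 0; 0, 0, 4; 0, 4, 0],
        !![0, 0, -4 * a; 0, 4, 0; -4 * a, 0, -12 * b]] := by
  obtain rfl : b = mu ^ 2 - lam ^ 3 - a * lam := by linear_combination -h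
  ext m k l
  rw [cubicTensor_apply]
  fin_cases m <;> fin_cases k <;> fin_cases l <;>
    simp [trace, Matrix.mul_apply, Fin.sum_univ_three, adjPolar_apply, Jmat] <;> ring

/-- The matrix of `cubicEnd` for the Pfaffian of `BmatEP`. -/
def weierstrassEnd (a b : S) : Matrix (Fin 9) (Fin 9) S :=
  !![0, 0, 0, 0, 0, 0, 0, 4 * a, 0;
      0, 0, 0, 0, -4, 0, 0, 0, 4;
      0, 4 * a, 0, 0, 0, 4, 0, 12 * b, 0;
      0, 0, 12, 0, 0, 0, -4 * a, 0, 0;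
      0, 0, 0, 4, 0, 0, 0, 0, 0;
      -4 * a, 0, 0, 0, 0, 0, -12 * b, 0, 4 * a;
      0, -12, 0, 0, 0, 0, 0, 0, 0;
      0, 0, 0, 0, 0, 0, -4, 0, 0;
      0, 0, 0, -4, 0, 0, 0, -4 * a, 0]

theorem cubicEnd_Jmat (a lam mu b : S) (h : mu ^ 2 = lam ^ 3 + a * lam + b) :
    cubicEnd (Jmat a lam mu) = (weierstrassEnd a b).submatrix finProdFinEquiv finProdFinEquiv := by
  ext ⟨i, k⟩ ⟨j, l⟩
  simp only [cubicEnd, submatrix_apply, koszul_apply, cubicTensor_Jmat a lam mu b h]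
  fin_cases i <;> fin_cases j <;> fin_cases k <;> fin_cases l <;>
    simp [crossMat, finProdFinEquiv, weierstrassEnd]

theorem weierstrassEnd_sq (a b : S) :
    weierstrassEnd a b * weierstrassEnd a b =
      !![0, 0, 0, 0, 0, 0, -16 * a, 0, 0;
      0, 0, 0, -32, 0, 0, 0, -16 * a, 0;
      -16 * a, 0, 0, 0, -16 * a, 0, -96 * b, 0, 32 * a;
      0, 96 * a, 0, 0, 0, 48, 0, 144 * b, 0;
      0, 0, 48, 0, 0, 0, -16 * a, 0, 0;
      0, 144 * b, 0, -16 * a, 0, 0, 0, -32 * a ^ 2, 0;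
      0, 0, 0, 0, 48, 0, 0, 0, -48;
      0, 48, 0, 0, 0, 0, 0, 0, 0;
      0, 0, -48, 0, 0, 0, 32 * a, 0, 0] := by
  ext i j
  fin_cases i <;> fin_cases j <;>
    simp [weierstrassEnd, Matrix.mul_apply, Fin.sum_univ_succ] <;> ring

theorem weierstrassEnd_cube (a b : S) :
    weierstrassEnd a b * weierstrassEnd a b * weierstrassEnd a b =
      !![0, 192 * a, 0, 0, 0, 0, 0, 0, 0;
      0, 0, -384, 0, 0, 0, 192 * a, 0, 0;
      0, 1152 * b, 0, -192 * a, 0, 0, 0, -192 * a ^ 2, 0;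
      -192 * a, 0, 0, 0, -384 * a, 0, -1152 * b, 0, 576 * a;
      0, 384 * a, 0, 0, 0, 192, 0, 576 * b, 0;
      0, 0, -192 * a, 0, -576 * b, 0, 192 * a ^ 2, 0, 576 * b;
      0, 0, 0, 384, 0, 0, 0, 192 * a, 0;
      0, 0, 0, 0, -192, 0, 0, 0, 192;
      0, -576 * a, 0, 0, 0, -192, 0, -576 * b, 0] := by
  rw [weierstrassEnd_sq]
  ext i j
  fin_cases i <;> fin_cases j <;>
    simp [weierstrassEnd, Matrix.mul_apply, Fin.sum_univ_succ] <;> ring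

theorem trace_cubicEnd_Jmat (a lam mu b : S) (h : mu ^ 2 = lam ^ 3 + a * lam + b) :
    trace (cubicEnd (Jmat a lam mu) ^ 4) = -18432 * a ∧
      trace (cubicEnd (Jmat a lam mu) ^ 6) = -2654208 * b := by
  rw [cubicEnd_Jmat a lam mu b h]
  constructor
  · rw [show 4 = 2 + 2 from rfl, pow_add, sq, submatrix_mul_equiv, trace_submatrix_equiv_sq,
      weierstrassEnd_sq]
    simp [trace, Fin.sum_univ_succ]
    ring
  · rw [show 6 = 3 + 3 from rfl, pow_add, pow_succ, sq, submatrix_mul_equiv, submatrix_mul_equiv,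
      trace_submatrix_equiv_sq, weierstrassEnd_cube]
    simp [trace, Fin.sum_univ_succ]
    ring

end ExplicitInvariants

section LinearEquivalence

variable {F : Type*} [Field F]

theorem pfaffFlat_transform {J J' : Fin 3 → Matrix (Fin 3) (Fin 3) F}
    {X : Matrix (Fin 3 ⊕ Fin 3) (Fin 3 ⊕ Fin 3) F} {Y : Matrix (Fin 3) (Fin 3) F} {c : F}
    (h : ∀ k l, c • coskewBlock (adjPolar (J' k) (J' l)) =
      ∑ p, ∑ q, (Y k p * Y l q) • (X * coskewBlock (adjPolar (J p) (J q)) * Xᵀ)) :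
    c • pfaffFlat J' = (X ⊗ₖ Y) * pfaffFlat J * (X ⊗ₖ Y)ᵀ := by
  ext ⟨i, k⟩ ⟨j, l⟩
  have h1 := congrFun (congrFun (h k l) i) j
  have h2 : (c • pfaffFlat J') (i, k) (j, l) =
      (c • coskewBlock (adjPolar (J' k) (J' l))) i j := rfl
  rw [h2, h1]
  simp only [Matrix.sum_apply, Matrix.smul_apply, smul_eq_mul, Matrix.mul_apply, transpose_apply,
    kronecker_apply, pfaffFlat, of_apply, Fintype.sum_prod_type, Finset.mul_sum, Finset.sum_mul]
  rw [Finset.sum_comm]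
  simp only [Finset.sum_comm (s := (Finset.univ : Finset (Fin 3)))
    (t := (Finset.univ : Finset (Fin 3 ⊕ Fin 3)))]
  refine Finset.sum_congr rfl fun s _ => Finset.sum_congr rfl fun r _ =>
    Finset.sum_congr rfl fun q _ => Finset.sum_congr rfl fun p _ => ?_
  ring

theorem cubicTensor_transform {J J' : Fin 3 → Matrix (Fin 3) (Fin 3) F}
    {X : Matrix (Fin 3 ⊕ Fin 3) (Fin 3 ⊕ Fin 3) F} {Y : Matrix (Fin 3) (Fin 3) F} {c : F}
    (hB : ∀ k, Xᵀ * skewBlock (J' k) * X = ∑ l, Y k l • skewBlock (J l))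
    (h : ∀ k l, c • coskewBlock (adjPolar (J' k) (J' l)) =
      ∑ p, ∑ q, (Y k p * Y l q) • (X * coskewBlock (adjPolar (J p) (J q)) * Xᵀ)) (m : Fin 3) :
    c • cubicTensor J' m = Y * (∑ r, Y m r • cubicTensor J r) * Yᵀ := by
  ext k l
  have h2 : (c • cubicTensor J' m) k l =
      trace ((c • coskewBlock (adjPolar (J' k) (J' l))) * skewBlock (J' m)) := by
    rw [smul_mul_assoc, trace_smul]
    rfl
  have h3 (A : Matrix (Fin 3 ⊕ Fin 3) (Fin 3 ⊕ Fin 3) F) :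
      trace (X * A * Xᵀ * skewBlock (J' m)) = ∑ r, Y m r * trace (A * skewBlock (J r)) := by
    rw [mul_assoc, mul_assoc, trace_mul_comm, mul_assoc, hB]
    simp [Finset.mul_sum, trace_sum]
  rw [h2, h]
  simp only [Finset.sum_mul, trace_sum, smul_mul_assoc, trace_smul, h3, smul_eq_mul]
  simp only [Matrix.mul_apply (M := Y), Matrix.mul_apply (N := Yᵀ), transpose_apply,
    Matrix.sum_apply, Matrix.smul_apply, cubicTensor, of_apply, smul_eq_mul, Finset.mul_sum,
    Finset.sum_mul]
  rw [Finset.sum_comm]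
  refine Finset.sum_congr rfl fun q _ => ?_
  rw [Finset.sum_comm]
  refine Finset.sum_congr rfl fun p _ => Finset.sum_congr rfl fun r _ => ?_
  ring

theorem cubicEnd_intertwine {J J' : Fin 3 → Matrix (Fin 3) (Fin 3) F}
    {Y : Matrix (Fin 3) (Fin 3) F} (hY : IsUnit Y.det) {c : F}
    (h : ∀ m, c • cubicTensor J' m = Y * (∑ r, Y m r • cubicTensor J r) * Yᵀ) :
    ((Y⁻¹)ᵀ ⊗ₖ Y) * (Y.det • cubicEnd J) = (c • cubicEnd J') * ((Y⁻¹)ᵀ ⊗ₖ Y) := by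
  have hYT : Yᵀ * (Y⁻¹)ᵀ = 1 := by rw [← transpose_mul, nonsing_inv_mul _ hY, transpose_one]
  have hYT' : (Y⁻¹)ᵀ * Yᵀ = 1 := by rw [← transpose_mul, mul_nonsing_inv _ hY, transpose_one]
  have h1 (m : Fin 3) : Y⁻¹ * (c • cubicTensor J' m) * (Y⁻¹)ᵀ = ∑ r, Y m r • cubicTensor J r := by
    rw [h, mul_assoc, mul_assoc, hYT, mul_one, ← mul_assoc, nonsing_inv_mul _ hY, one_mul]
  have h2 := congrArg (fun M => M.submatrix Prod.swap id)
    (koszul_transform (B' := fun m => c • cubicTensor J' m) h1)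
  have h3 : (koszul fun m => c • cubicTensor J' m) = c • koszul (cubicTensor J') := by
    simp [koszul, Finset.smul_sum, smul_kronecker]
  have h4 : ((Y⁻¹ ⊗ₖ Yᵀ) * (koszul fun m => c • cubicTensor J' m) *
      ((Y⁻¹)ᵀ ⊗ₖ Y)).submatrix Prod.swap id =
      (Yᵀ ⊗ₖ Y⁻¹) * (c • cubicEnd J') * ((Y⁻¹)ᵀ ⊗ₖ Y) := by
    rw [h3, submatrix_mul _ _ _ id _ Function.bijective_id,
      submatrix_mul _ _ _ Prod.swap _ Prod.swap_bijective]
    congr 2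
    ext ⟨i, j⟩ ⟨k, l⟩
    simp [mul_comm]
  have h5 : Y.det • cubicEnd J = (Yᵀ ⊗ₖ Y⁻¹) * (c • cubicEnd J') * ((Y⁻¹)ᵀ ⊗ₖ Y) := by
    rw [← h4, h2]
    rfl
  rw [h5, ← mul_assoc, ← mul_assoc, ← mul_kronecker_mul, hYT', mul_nonsing_inv _ hY,
    one_kronecker_one, one_mul]

theorem det_Jmat_zero (a lam mu : F) : (Jmat a lam mu 0).det = -1 := by
  simp [Jmat, det_fin_three]

/-- Equivalent tensors have equivalent Weierstrass data. -/
theorem exists_scaling_of_congruence (h2 : (2 : F) ≠ 0) (h3 : (3 : F) ≠ 0)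
    {a b lam mu a' b' lam' mu' : F}
    (hP : mu ^ 2 = lam ^ 3 + a * lam + b) (hP' : mu' ^ 2 = lam' ^ 3 + a' * lam' + b')
    {X : Matrix (Fin 3 ⊕ Fin 3) (Fin 3 ⊕ Fin 3) F} {Y : Matrix (Fin 3) (Fin 3) F}
    (hX : IsUnit X.det) (hY : IsUnit Y.det)
    (h : ∀ k, Xᵀ * BmatEP a' lam' mu' k * X = ∑ l, Y k l • BmatEP a lam mu l) :
    ∃ u : F, u ≠ 0 ∧ a = u ^ 4 * a' ∧ b = u ^ 6 * b' ∧ lam = u ^ 2 * lam' ∧ mu = u ^ 3 * mu' := by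
  have hB : ∀ k, Xᵀ * skewBlock (Jmat a' lam' mu' k) * X =
      ∑ l, Y k l • skewBlock (Jmat a lam mu l) := h
  obtain ⟨c, hc, hN⟩ := exists_adjPolar_transform hB hY (by rw [det_Jmat_zero]; simp)
  have hd : Y.det ≠ 0 := hY.ne_zero
  have hc0 : c ≠ 0 := by
    rintro rfl
    exact hX.ne_zero (by simpa using hc.symm)
  set D := Y.det
  have hlam : c ^ 2 * lam' = D ^ 2 * lam := by
    have hZ : IsUnit (X ⊗ₖ Y) := by
      rw [isUnit_iff_isUnit_det, det_kronecker]
      exact (hX.pow _).mul (hY.pow _)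
    have hK : _ = D • _ := koszul_transform hB
    rw [kroneckerMap_transpose] at hK
    have hM : (c • (pfaffFlat (Jmat a' lam' mu') * koszul fun k => skewBlock (Jmat a' lam' mu' k))) *
        (X ⊗ₖ Y) = (X ⊗ₖ Y) *
          (D • (pfaffFlat (Jmat a lam mu) * koszul fun k => skewBlock (Jmat a lam mu k))) := by
      rw [← mul_smul_comm D, ← hK, ← smul_mul_assoc c, pfaffFlat_transform hN]
      simp only [mul_assoc]
    have ht := trace_pow_eq_of_intertwine hZ hM 2
    rw [smul_pow, smul_pow, trace_smul, trace_smul, trace_pfaffFlat_mul_koszul_sq,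
      trace_pfaffFlat_mul_koszul_sq, trace_adjFlat_mul_koszul_sq_Jmat,
      trace_adjFlat_mul_koszul_sq_Jmat, smul_eq_mul, smul_eq_mul] at ht
    exact mul_left_cancel₀ (mul_ne_zero (pow_ne_zero 4 h2) (pow_ne_zero 2 h3))
      (by linear_combination ht)
  have hZ : IsUnit ((Y⁻¹)ᵀ ⊗ₖ Y) := by
    rw [isUnit_iff_isUnit_det, det_kronecker, det_transpose]
    exact ((isUnit_nonsing_inv_det _ hY).pow _).mul (hY.pow _)
  have hL := cubicEnd_intertwine hY (cubicTensor_transform hB hN)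
  have ha : c ^ 4 * a' = D ^ 4 * a := by
    have ht := trace_pow_eq_of_intertwine hZ hL.symm 4
    rw [smul_pow, smul_pow, trace_smul, trace_smul, (trace_cubicEnd_Jmat _ _ _ _ hP).1,
      (trace_cubicEnd_Jmat _ _ _ _ hP').1, smul_eq_mul, smul_eq_mul] at ht
    exact mul_left_cancel₀ (mul_ne_zero (pow_ne_zero 11 h2) (pow_ne_zero 2 h3))
      (by linear_combination -ht)
  have hb : c ^ 6 * b' = D ^ 6 * b := by
    have ht := trace_pow_eq_of_intertwine hZ hL.symm 6
    rw [smul_pow, smul_pow, trace_smul, trace_smul, (trace_cubicEnd_Jmat _ _ _ _ hP).2,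
      (trace_cubicEnd_Jmat _ _ _ _ hP').2, smul_eq_mul, smul_eq_mul] at ht
    exact mul_left_cancel₀ (mul_ne_zero (pow_ne_zero 15 h2) (pow_ne_zero 4 h3))
      (by linear_combination -ht)
  obtain ⟨v, rfl⟩ : ∃ v, c = v * D := ⟨c / D, by field_simp⟩
  have hv : v ≠ 0 := left_ne_zero_of_mul hc0
  have ha' : a = v ^ 4 * a' := mul_left_cancel₀ (pow_ne_zero 4 hd) (by linear_combination -ha)
  have hb' : b = v ^ 6 * b' := mul_left_cancel₀ (pow_ne_zero 6 hd) (by linear_combination -hb)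
  have hl' : lam = v ^ 2 * lam' := mul_left_cancel₀ (pow_ne_zero 2 hd) (by linear_combination -hlam)
  have hmu : mu ^ 2 = (v ^ 3 * mu') ^ 2 := by
    rw [hP, ha', hb', hl']
    linear_combination -v ^ 6 * hP'
  rcases sq_eq_sq_iff_eq_or_eq_neg.mp hmu with hm | hm
  · exact ⟨v, hv, ha', hb', hl', hm⟩
  · exact ⟨-v, neg_ne_zero.mpr hv, by rw [ha']; ring, by rw [hb']; ring, by rw [hl']; ring,
      by rw [hm]; ring⟩

end LinearEquivalence

section Tensor

variable {F : Type*} [Field F] (a lam mu : F)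

theorem epTensor_add_right (u v v' : Fin 3 ⊕ Fin 3 → F) :
    epTensor a lam mu u (v + v') = epTensor a lam mu u v + epTensor a lam mu u v' := by
  ext k; simp [epTensor, matTensor, mulVec_add, dotProduct_add]

theorem epTensor_smul_left (c : F) (u v : Fin 3 ⊕ Fin 3 → F) :
    epTensor a lam mu (c • u) v = c • epTensor a lam mu u v := by
  ext k; simp [epTensor, matTensor]

theorem epTensor_smul_right (c : F) (u v : Fin 3 ⊕ Fin 3 → F) :
    epTensor a lam mu u (c • v) = c • epTensor a lam mu u v := by
  ext k; simp [epTensor, matTensor, mulVec_smul]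

theorem epTensor_zero_left (v : Fin 3 ⊕ Fin 3 → F) : epTensor a lam mu 0 v = 0 := by
  ext k; simp [epTensor, matTensor]

theorem epTensor_zero_right (v : Fin 3 ⊕ Fin 3 → F) : epTensor a lam mu v 0 = 0 := by
  ext k; simp [epTensor, matTensor]

theorem epTensor_swap (u v : Fin 3 ⊕ Fin 3 → F) :
    epTensor a lam mu u v = -epTensor a lam mu v u := by
  ext k
  fin_cases k <;>
    simp [epTensor, matTensor, BmatEP, Jmat, dotProduct, mulVec, Fin.sum_univ_three] <;> ring

theorem epTensor_single_inl (i : Fin 3) (v : Fin 3 ⊕ Fin 3 → F) (k : Fin 3) :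
    epTensor a lam mu (Pi.single (Sum.inl i) 1) v k =
      ∑ j, Jmat a lam mu k i j * v (Sum.inr j) := by
  rw [epTensor, matTensor, single_one_dotProduct]
  simp [BmatEP, mulVec, dotProduct]

theorem epTensor_single_inr (i : Fin 3) (v : Fin 3 ⊕ Fin 3 → F) (k : Fin 3) :
    epTensor a lam mu (Pi.single (Sum.inr i) 1) v k =
      -∑ j, Jmat a lam mu k j i * v (Sum.inl j) := by
  rw [epTensor, matTensor, single_one_dotProduct]
  simp [BmatEP, mulVec, dotProduct]

theorem eq_zero_of_epTensor_eq_zero {v : Fin 3 ⊕ Fin 3 → F}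
    (h : ∀ u, epTensor a lam mu u v = 0) : v = 0 := by
  have hl (i : Fin 3) := congrFun (h (Pi.single (Sum.inl i) 1)) 0
  have hr (i : Fin 3) := congrFun (h (Pi.single (Sum.inr i) 1)) 0
  simp only [epTensor_single_inl, epTensor_single_inr, Fin.sum_univ_three] at hl hr
  have hl0 := hl 0
  have hl1 := hl 1
  have hl2 := hl 2
  have hr0 := hr 0
  have hr1 := hr 1
  have hr2 := hr 2
  simp [Jmat] at hl0 hl1 hl2 hr0 hr1 hr2
  rw [hl2] at hl1
  rw [hr2] at hr1
  ext i
  rcases i with i | i <;> fin_cases i <;> simp_all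

theorem exists_epTensor_sum_eq (w : Fin 3 → F) : ∃ u₁ v₁ u₂ v₂ u₃ v₃,
    w = epTensor a lam mu u₁ v₁ + epTensor a lam mu u₂ v₂ + epTensor a lam mu u₃ v₃ := by
  refine ⟨Pi.single (Sum.inl 1) 1, Pi.single (Sum.inr 2) (w 0), Pi.single (Sum.inl 0) 1,
    Pi.single (Sum.inr 1) (w 1), Pi.single (Sum.inl 2) 1,
    Pi.single (Sum.inr 2) (-(w 2 + mu * w 1)), ?_⟩
  ext k
  simp only [Pi.add_apply, epTensor_single_inl]
  fin_cases k <;> simp [Fin.sum_univ_three, Jmat]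

/-- The centroid of the tensor consists of scalars. -/
theorem exists_scalar_of_centroid {f : (Fin 3 ⊕ Fin 3 → F) → (Fin 3 ⊕ Fin 3 → F)}
    (g : (Fin 3 → F) →+ (Fin 3 → F))
    (h : ∀ u v, epTensor a lam mu u (f v) = g (epTensor a lam mu u v)) :
    ∃ γ : F, (∀ w, g w = γ • w) ∧ ∀ v, f v = γ • v := by
  have hg (c : F) (w : Fin 3 → F) : g (c • w) = c • g w := by
    obtain ⟨u₁, v₁, u₂, v₂, u₃, v₃, rfl⟩ := exists_epTensor_sum_eq a lam mu w
    simp only [smul_add, map_add, ← h, ← epTensor_smul_left]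
  set x := g (Pi.single 0 1) with hx
  set y := g (Pi.single 1 1) with hy
  set z := g (Pi.single 2 1) with hz
  have hgw (w : Fin 3 → F) (k : Fin 3) : g w k = w 0 * x k + w 1 * y k + w 2 * z k := by
    have hw : w = w 0 • Pi.single 0 1 + w 1 • Pi.single 1 1 + w 2 • Pi.single 2 1 := by
      ext i; fin_cases i <;> simp
    conv_lhs => rw [hw]
    simp [hg, hx, hy, hz]
  set q := f (Pi.single (Sum.inr 0) 1)
  set r := f (Pi.single (Sum.inr 2) 1)
  have hq (i k : Fin 3) : ∑ j, Jmat a lam mu k i j * q (Sum.inr j) =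
      Jmat a lam mu 0 i 0 * x k + Jmat a lam mu 1 i 0 * y k + Jmat a lam mu 2 i 0 * z k := by
    have := congrFun (h (Pi.single (Sum.inl i) 1) (Pi.single (Sum.inr 0) 1)) k
    rw [hgw] at this
    simpa [epTensor_single_inl, Pi.single_apply] using this
  have hr (i k : Fin 3) : ∑ j, Jmat a lam mu k i j * r (Sum.inr j) =
      Jmat a lam mu 0 i 2 * x k + Jmat a lam mu 1 i 2 * y k + Jmat a lam mu 2 i 2 * z k := by
    have := congrFun (h (Pi.single (Sum.inl i) 1) (Pi.single (Sum.inr 2) 1)) k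
    rw [hgw] at this
    simpa [epTensor_single_inl, Pi.single_apply] using this
  have q0 := fun k => hq 0 k
  have q1 := fun k => hq 1 k
  have q2 := fun k => hq 2 k
  have r0 := fun k => hr 0 k
  have r1 := fun k => hr 1 k
  have r2 := fun k => hr 2 k
  simp [Fin.forall_fin_succ, Fin.sum_univ_three, Jmat] at q0 q1 q2 r0 r1 r2
  obtain ⟨q00, q01, -⟩ := q0
  obtain ⟨q10, q11, q12⟩ := q1
  obtain ⟨q20, q21⟩ := q2
  obtain ⟨r00, r01, -⟩ := r0
  obtain ⟨r10, r11, r12⟩ := r1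
  obtain ⟨r20, r21, r22⟩ := r2
  have hz0 : z 0 = 0 := by linear_combination r20 - r01
  have hx0 : x 0 = z 2 := by linear_combination -r10 + r22 + lam * r01
  have hx1 : x 1 = 0 := by linear_combination -r11 + r00
  have hx2 : x 2 = 0 := by linear_combination -r12 + mu * r00 + (a + lam ^ 2) * r01
  have hq0 : q (Sum.inr 0) = z 2 := by linear_combination q00 + hx0 - lam * hz0
  have hy0 : y 0 = 0 := by linear_combination -q10 + q21 + lam * q20 - mu * hz0
  have hy1 : y 1 = z 2 := by linear_combination -q11 + hq0 - mu * r21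
  have hy2 : y 2 = 0 := by
    linear_combination -q12 + mu * hq0 + (a + lam ^ 2) * q20
  have hgs (w : Fin 3 → F) : g w = z 2 • w := by
    ext k
    rw [hgw]
    fin_cases k <;> simp [hx0, hx1, hx2, hy0, hy1, hy2, hz0, r21, mul_comm]
  refine ⟨z 2, hgs, fun v => sub_eq_zero.1 (eq_zero_of_epTensor_eq_zero a lam mu fun u => ?_)⟩
  rw [sub_eq_add_neg, ← neg_smul, epTensor_add_right, epTensor_smul_right, h, hgs, neg_smul,
    add_neg_cancel]

end Tensor

section BaerGroup

variable {F : Type*} [Field F] {a lam mu a' lam' mu' : F}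

theorem baerMul_epTensor_comm_iff (h2 : (2 : F) ≠ 0) (x : (Fin 3 ⊕ Fin 3 → F) × (Fin 3 → F)) :
    (∀ y, baerMul (K := F) (epTensor a lam mu) x y = baerMul (K := F) (epTensor a lam mu) y x) ↔
      x.1 = 0 := by
  constructor
  · intro h
    refine eq_zero_of_epTensor_eq_zero a lam mu fun u => ?_
    have h' := congrArg Prod.snd (h (u, 0))
    simp only [baerMul, epTensor_swap a lam mu x.1 u] at h'
    ext k
    have h'' := congrFun h' k
    simp only [Pi.add_apply, Pi.smul_apply, Pi.neg_apply, Pi.zero_apply, smul_eq_mul] at h'' ⊢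
    field_simp at h''
    have : 2 * epTensor a lam mu u x.1 k = 0 := by linear_combination -h''
    exact (mul_eq_zero.1 this).resolve_left h2
  · intro h y
    simp [baerMul, h, epTensor_zero_left, epTensor_zero_right, add_comm]

variable {e : (Fin 3 ⊕ Fin 3 → F) × (Fin 3 → F) ≃ (Fin 3 ⊕ Fin 3 → F) × (Fin 3 → F)}

theorem baerMul_symm_apply
    (he : ∀ x y, e (baerMul (K := F) (epTensor a lam mu) x y) =
      baerMul (K := F) (epTensor a' lam' mu') (e x) (e y))
    (x y : (Fin 3 ⊕ Fin 3 → F) × (Fin 3 → F)) :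
    e.symm (baerMul (K := F) (epTensor a' lam' mu') x y) =
      baerMul (K := F) (epTensor a lam mu) (e.symm x) (e.symm y) :=
  e.injective (by simp [he])

theorem baerMul_map_fst_eq_zero (h2 : (2 : F) ≠ 0)
    (he : ∀ x y, e (baerMul (K := F) (epTensor a lam mu) x y) =
      baerMul (K := F) (epTensor a' lam' mu') (e x) (e y)) (w : Fin 3 → F) :
    (e (0, w)).1 = 0 := by
  refine (baerMul_epTensor_comm_iff (a := a') (lam := lam') (mu := mu') h2 _).1 fun y => ?_
  obtain ⟨y, rfl⟩ := e.surjective y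
  rw [← he, ← he, (baerMul_epTensor_comm_iff h2 (0, w)).2 rfl]

theorem baerMul_map_fst (h2 : (2 : F) ≠ 0)
    (he : ∀ x y, e (baerMul (K := F) (epTensor a lam mu) x y) =
      baerMul (K := F) (epTensor a' lam' mu') (e x) (e y))
    (v : Fin 3 ⊕ Fin 3 → F) (w : Fin 3 → F) : (e (v, w)).1 = (e (v, 0)).1 := by
  have h := congrArg Prod.fst (he (v, 0) (0, w))
  simpa [baerMul, epTensor_zero_right, baerMul_map_fst_eq_zero h2 he] using h

/-- An isomorphism of Baer groups induces a pseudo-isometry of the tensors. -/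
theorem exists_pseudoIsometry_of_baerMul (h2 : (2 : F) ≠ 0)
    (he : ∀ x y, e (baerMul (K := F) (epTensor a lam mu) x y) =
      baerMul (K := F) (epTensor a' lam' mu') (e x) (e y)) :
    ∃ (φ : (Fin 3 ⊕ Fin 3 → F) ≃+ (Fin 3 ⊕ Fin 3 → F)) (ψ : (Fin 3 → F) ≃+ (Fin 3 → F)),
      ∀ u v, epTensor a' lam' mu' (φ u) (φ v) = ψ (epTensor a lam mu u v) := by
  have he' := baerMul_symm_apply he
  have hfst := baerMul_map_fst h2 he
  have hfst' := baerMul_map_fst h2 he'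
  have hz := baerMul_map_fst_eq_zero h2 he
  have hz' := baerMul_map_fst_eq_zero h2 he'
  let φ : (Fin 3 ⊕ Fin 3 → F) ≃+ (Fin 3 ⊕ Fin 3 → F) :=
    { toFun := fun v => (e (v, 0)).1
      invFun := fun v => (e.symm (v, 0)).1
      left_inv := fun v => by
        change (e.symm ((e (v, 0)).1, 0)).1 = v
        rw [← hfst' _ (e (v, 0)).2]
        simp
      right_inv := fun v => by
        change (e ((e.symm (v, 0)).1, 0)).1 = v
        rw [← hfst _ (e.symm (v, 0)).2]
        simp
      map_add' := fun u v => by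
        have h := congrArg Prod.fst (he (u, 0) (v, 0))
        rwa [baerMul, hfst] at h }
  let ψ : (Fin 3 → F) ≃+ (Fin 3 → F) :=
    { toFun := fun w => (e (0, w)).2
      invFun := fun w => (e.symm (0, w)).2
      left_inv := fun w => by
        change (e.symm (0, (e (0, w)).2)).2 = w
        rw [show ((0 : Fin 3 ⊕ Fin 3 → F), (e (0, w)).2) = e (0, w) from
          Prod.ext (hz w).symm rfl, e.symm_apply_apply]
      right_inv := fun w => by
        change (e (0, (e.symm (0, w)).2)).2 = w
        rw [show ((0 : Fin 3 ⊕ Fin 3 → F), (e.symm (0, w)).2) = e.symm (0, w) from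
          Prod.ext (hz' w).symm rfl, e.apply_symm_apply]
      map_add' := fun w w' => by
        have h := congrArg Prod.snd (he (0, w) (0, w'))
        simpa [baerMul, epTensor_zero_right, hz] using h }
  refine ⟨φ, ψ, fun u v => ?_⟩
  have hcomm : baerMul (K := F) (epTensor a lam mu) (u, 0) (v, 0) =
      baerMul (K := F) (epTensor a lam mu)
        (baerMul (K := F) (epTensor a lam mu) (v, 0) (u, 0)) (0, epTensor a lam mu u v) := by
    have hs := epTensor_swap a lam mu v u
    ext k
    · simp [baerMul, add_comm]
    · simp only [baerMul, epTensor_zero_right, hs]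
      simp only [Pi.add_apply, Pi.smul_apply, Pi.neg_apply, Pi.zero_apply, smul_eq_mul]
      field_simp
      ring
  have h := congrArg Prod.snd (congrArg e hcomm)
  rw [he, he, he] at h
  simp only [baerMul, hz, epTensor_zero_right] at h
  change epTensor a' lam' mu' (e (u, 0)).1 (e (v, 0)).1 = (e (0, epTensor a lam mu u v)).2
  rw [epTensor_swap a' lam' mu' (e (v, 0)).1] at h
  ext k
  have hk := congrFun h k
  simp only [Pi.add_apply, Pi.smul_apply, Pi.neg_apply, Pi.zero_apply, smul_eq_mul] at hk
  field_simp at hk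
  have h0 : 2 * (epTensor a' lam' mu' (e (u, 0)).1 (e (v, 0)).1 k -
      (e (0, epTensor a lam mu u v)).2 k) = 0 := by linear_combination hk
  exact sub_eq_zero.1 ((mul_eq_zero.1 h0).resolve_left h2)

/-- Pseudo-isometries of the tensors are semilinear. -/
theorem exists_ringEquiv_of_pseudoIsometry [Finite F]
    (φ : (Fin 3 ⊕ Fin 3 → F) ≃+ (Fin 3 ⊕ Fin 3 → F)) (ψ : (Fin 3 → F) ≃+ (Fin 3 → F))
    (h : ∀ u v, epTensor a' lam' mu' (φ u) (φ v) = ψ (epTensor a lam mu u v)) :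
    ∃ σ : F ≃+* F, (∀ c w, ψ (c • w) = σ c • ψ w) ∧ ∀ c v, φ (c • v) = σ c • φ v := by
  have key (c : F) : ∃ γ : F, (∀ w, ψ (c • w) = γ • ψ w) ∧ ∀ v, φ (c • v) = γ • φ v := by
    obtain ⟨γ, hg, hf⟩ := exists_scalar_of_centroid a' lam' mu' (f := fun v => φ (c • φ.symm v))
      ((ψ.toAddMonoidHom.comp (DistribSMul.toAddMonoidHom (Fin 3 → F) c)).comp
        ψ.symm.toAddMonoidHom) (fun u v => by
          obtain ⟨u, rfl⟩ := φ.surjective u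
          obtain ⟨v, rfl⟩ := φ.surjective v
          simp [h, epTensor_smul_right])
    exact ⟨γ, fun w => by simpa using hg (ψ w), fun v => by simpa using hf (φ v)⟩
  choose σ hψ hφ using key
  obtain ⟨v, hv⟩ : ∃ v : Fin 3 ⊕ Fin 3 → F, φ v ≠ 0 :=
    ⟨φ.symm 1, by simp⟩
  have hinj : Function.Injective fun c : F => c • φ v := smul_left_injective F hv
  let τ : F →+* F :=
    { toFun := σ
      map_one' := hinj (by simp [← hφ])
      map_mul' := fun c d => hinj (by simp [← hφ, mul_smul])
      map_zero' := hinj (by simp [← hφ])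
      map_add' := fun c d => hinj (by simp [← hφ, add_smul]) }
  exact ⟨RingEquiv.ofBijective τ (Finite.injective_iff_bijective.1 τ.injective), hψ, hφ⟩

theorem map_BmatEP {R : Type*} [CommRing R] (σ : F →+* R) (k : Fin 3) :
    (BmatEP a lam mu k).map σ = BmatEP (σ a) (σ lam) (σ mu) k := by
  ext i j
  rcases i with i | i <;> rcases j with j | j <;> fin_cases k <;> fin_cases i <;> fin_cases j <;>
    simp [BmatEP, Jmat]

theorem epTensor_single_single (i j : Fin 3 ⊕ Fin 3) (k : Fin 3) :
    epTensor a lam mu (Pi.single i 1) (Pi.single j 1) k = BmatEP a lam mu k i j := by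
  simp [epTensor, matTensor]

/-- A semilinear bijection is given by an invertible matrix. -/
theorem exists_isUnit_det_of_semilinear {ι : Type*} [Fintype ι] [DecidableEq ι] (σ : F ≃+* F)
    (φ : (ι → F) ≃+ (ι → F)) (h : ∀ (c : F) v, φ (c • v) = σ c • φ v) :
    ∃ X : Matrix ι ι F, IsUnit X.det ∧ ∀ v, φ v = X *ᵥ (σ ∘ v) := by
  have hX (v : ι → F) : φ v = (Matrix.of fun i j => φ (Pi.single j 1) i) *ᵥ (σ ∘ v) := by
    conv_lhs => rw [← Finset.univ_sum_single v]
    ext i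
    simp only [map_sum, Finset.sum_apply, mulVec, dotProduct, of_apply, Function.comp_apply]
    refine Finset.sum_congr rfl fun j _ => ?_
    rw [show (Pi.single j (v j) : ι → F) = v j • Pi.single j 1 by simp [← Pi.single_smul], h]
    simp [mul_comm]
  refine ⟨_, ?_, hX⟩
  rw [← Matrix.isUnit_iff_isUnit_det, ← Matrix.mulVec_surjective_iff_isUnit]
  intro w
  refine ⟨σ ∘ φ.symm w, ?_⟩
  rw [← hX, φ.apply_symm_apply]

theorem exists_congruence_of_pseudoIsometry (σ : F ≃+* F)
    {φ : (Fin 3 ⊕ Fin 3 → F) ≃+ (Fin 3 ⊕ Fin 3 → F)} {ψ : (Fin 3 → F) ≃+ (Fin 3 → F)}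
    (h : ∀ u v, epTensor a' lam' mu' (φ u) (φ v) = ψ (epTensor a lam mu u v))
    (hψ : ∀ c w, ψ (c • w) = σ c • ψ w) (hφ : ∀ c v, φ (c • v) = σ c • φ v) :
    ∃ (X : Matrix (Fin 3 ⊕ Fin 3) (Fin 3 ⊕ Fin 3) F) (Y : Matrix (Fin 3) (Fin 3) F),
      IsUnit X.det ∧ IsUnit Y.det ∧ ∀ k, Xᵀ * BmatEP a' lam' mu' k * X =
        ∑ l, Y k l • BmatEP (σ a) (σ lam) (σ mu) l := by
  obtain ⟨X, hX, hφX⟩ := exists_isUnit_det_of_semilinear σ φ hφ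
  obtain ⟨Y, hY, hψY⟩ := exists_isUnit_det_of_semilinear σ ψ hψ
  refine ⟨X, Y, hX, hY, fun k => ?_⟩
  ext i j
  have hs (j : Fin 3 ⊕ Fin 3) : φ (Pi.single j 1) = X *ᵥ Pi.single j 1 := by
    rw [hφX]
    congr 1
    ext i
    by_cases hij : i = j <;> simp [hij]
  have hij := congrFun (h (Pi.single i 1) (Pi.single j 1)) k
  rw [hψY, hs, hs] at hij
  simp only [Matrix.sum_apply, Matrix.smul_apply, smul_eq_mul]
  trans epTensor a' lam' mu' (X *ᵥ Pi.single i 1) (X *ᵥ Pi.single j 1) k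
  · rw [epTensor, matTensor, dotProduct_mulVec, ← dotProduct_mulVec, ← vecMul_transpose,
      ← dotProduct_mulVec, mulVec_mulVec, mulVec_mulVec, single_one_dotProduct]
    simp [Matrix.mul_assoc]
  · rw [hij, mulVec, dotProduct]
    refine Finset.sum_congr rfl fun l _ => ?_
    rw [Function.comp_apply, epTensor_single_single]
    exact congrArg _ (congrFun (congrFun (map_BmatEP (σ : F →+* F) l) i) j)

end BaerGroup

section Scaling

variable {F : Type*} [Field F] {a lam mu a' lam' mu' : F}

/-- The weights of the coordinates `x, y, z` under the scaling action. -/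
def coordWeight (u : F) : Fin 3 → F := ![u ^ 2, u ^ 3, 1]

/-- The weights of the rows and columns of `Jmat` under the scaling action. -/
def entryWeight (u : F) : Fin 3 ⊕ Fin 3 → F := Sum.elim ![u, u ^ 2, 1] ![u, u ^ 2, 1]

theorem epTensor_entryWeight_mul (u a lam mu : F) (v w : Fin 3 ⊕ Fin 3 → F) :
    epTensor a lam mu (entryWeight u * v) (entryWeight u * w) =
      coordWeight u * epTensor (u ^ 4 * a) (u ^ 2 * lam) (u ^ 3 * mu) v w := by
  ext k
  fin_cases k <;>
    simp [epTensor, matTensor, BmatEP, Jmat, dotProduct, mulVec, Fin.sum_univ_three,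
      coordWeight, entryWeight] <;> ring

theorem epTensor_map (σ : F →+* F) (v w : Fin 3 ⊕ Fin 3 → F) :
    epTensor (σ a) (σ lam) (σ mu) (σ ∘ v) (σ ∘ w) = σ ∘ epTensor a lam mu v w := by
  ext k
  simp only [epTensor, matTensor, Function.comp_apply, ← map_BmatEP, RingHom.map_dotProduct]
  congr 1
  ext i
  simp [RingHom.map_mulVec]

/-- The semilinear bijection applying `σ` and then rescaling the coordinates by `d`. -/
def semilinearDiagonal {ι : Type*} (σ : F ≃+* F) (d : ι → F) (hd : ∀ i, d i ≠ 0) :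
    (ι → F) ≃ (ι → F) :=
  Equiv.piCongrRight fun i => σ.toEquiv.trans (Equiv.mulLeft₀ (d i) (hd i))

theorem semilinearDiagonal_apply {ι : Type*} (σ : F ≃+* F) (d : ι → F) (hd : ∀ i, d i ≠ 0)
    (v : ι → F) : semilinearDiagonal σ d hd v = d * (σ ∘ v) := rfl

theorem exists_baerMul_equiv (σ : F ≃+* F) {u : F} (hu : u ≠ 0) (ha : σ a = u ^ 4 * a')
    (hlam : σ lam = u ^ 2 * lam') (hmu : σ mu = u ^ 3 * mu') :
    ∃ e : ((Fin 3 ⊕ Fin 3) → F) × (Fin 3 → F) ≃ ((Fin 3 ⊕ Fin 3) → F) × (Fin 3 → F),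
      ∀ x y, e (baerMul (K := F) (epTensor a lam mu) x y) =
        baerMul (K := F) (epTensor a' lam' mu') (e x) (e y) := by
  have hd : ∀ i, entryWeight u i ≠ 0 := by
    rintro (i | i) <;> fin_cases i <;> simp [entryWeight, hu]
  have hs : ∀ i, coordWeight u i ≠ 0 := by
    intro i; fin_cases i <;> simp [coordWeight, hu]
  refine ⟨(semilinearDiagonal σ _ hd).prodCongr (semilinearDiagonal σ _ hs), fun x y => ?_⟩
  have ht : epTensor a' lam' mu' (entryWeight u * (σ ∘ x.1)) (entryWeight u * (σ ∘ y.1)) =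
      coordWeight u * (σ ∘ epTensor a lam mu x.1 y.1) := by
    rw [epTensor_entryWeight_mul, ← ha, ← hlam, ← hmu]
    exact congrArg _ (epTensor_map (σ : F →+* F) x.1 y.1)
  simp only [Equiv.prodCongr_apply, Prod.map, semilinearDiagonal_apply, baerMul, ht]
  ext k
  · simp [mul_add]
  · simp [mul_add, mul_left_comm, map_ofNat σ 2]

end Scaling

/-- For a finite field `F` of characteristic `p ≥ 5`, elliptic curves
`E : y² = x³ + ax + b`, `E' : y² = x³ + a'x + b'` over `F` and affine points
`P = (λ, μ) ∈ E(F)`, `P' = (λ', μ') ∈ E'(F)`, the Baer groups `G_{E,P}(F)` and `G_{E',P'}(F)`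
are isomorphic (as abstract groups) if and only if there exist `σ ∈ Gal(F/F_p)` (equivalently,
a ring automorphism of `F`) and `u ∈ F^×` with `σ(a) = u⁴a'`, `σ(b) = u⁶b'`, `σ(λ) = u²λ'`,
`σ(μ) = u³μ'`. -/
theorem statement0 {F : Type*} [Field F] [Fintype F] (p : ℕ) [CharP F p] (hp : 5 ≤ p)
    (a b lam mu a' b' lam' mu' : F)
    (hE : 4 * a ^ 3 + 27 * b ^ 2 ≠ 0) (hE' : 4 * a' ^ 3 + 27 * b' ^ 2 ≠ 0)
    (hP : mu ^ 2 = lam ^ 3 + a * lam + b) (hP' : mu' ^ 2 = lam' ^ 3 + a' * lam' + b') :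
    (∃ e : ((Fin 3 ⊕ Fin 3) → F) × (Fin 3 → F) ≃ ((Fin 3 ⊕ Fin 3) → F) × (Fin 3 → F),
        ∀ x y, e (baerMul (K := F) (epTensor a lam mu) x y) =
          baerMul (K := F) (epTensor a' lam' mu') (e x) (e y)) ↔
    (∃ σ : F ≃+* F, ∃ u : F, u ≠ 0 ∧
        σ a = u ^ 4 * a' ∧ σ b = u ^ 6 * b' ∧ σ lam = u ^ 2 * lam' ∧ σ mu = u ^ 3 * mu') := by
  have hne (n : ℕ) (hn : n < p) (h0 : 0 < n) : (n : F) ≠ 0 := fun h =>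
    absurd (Nat.le_of_dvd h0 ((CharP.cast_eq_zero_iff F p n).1 h)) (by lia)
  have h2 : (2 : F) ≠ 0 := by exact_mod_cast hne 2 (by lia) (by lia)
  have h3 : (3 : F) ≠ 0 := by exact_mod_cast hne 3 (by lia) (by lia)
  constructor
  · rintro ⟨e, he⟩
    obtain ⟨φ, ψ, h⟩ := exists_pseudoIsometry_of_baerMul h2 he
    obtain ⟨σ, hψ, hφ⟩ := exists_ringEquiv_of_pseudoIsometry φ ψ h
    obtain ⟨X, Y, hX, hY, hXY⟩ := exists_congruence_of_pseudoIsometry σ h hψ hφ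
    have hσP : σ mu ^ 2 = σ lam ^ 3 + σ a * σ lam + σ b := by
      simpa using congrArg σ hP
    exact ⟨σ, exists_scaling_of_congruence h2 h3 hσP hP' hX hY hXY⟩
  · rintro ⟨σ, u, hu, ha, -, hlam, hmu⟩
    exact exists_baerMul_equiv σ hu ha hlam hmu
end

section
/- Let K be a field of characteristic p > 2 and let s : V × V → T and t : V' × V' → T' be alternating, full K-tensors. Then the K-Lie algebras L_s(K) and L_t(K) are isomorphic if and only if s and t are K-pseudo-isometric. -/
/-- A linear map that sends the values of a full bilinear map `s` into `0 × T'` sends all of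
`0 × T` there. -/
theorem fst_map_inr_eq_zero_of_full {K V T V' T' : Type*} [Field K]
    [AddCommGroup V] [Module K V] [AddCommGroup T] [Module K T]
    [AddCommGroup V'] [Module K V'] [AddCommGroup T'] [Module K T']
    (s : V →ₗ[K] V →ₗ[K] T) (hs : Submodule.span K {w | ∃ u v, s u v = w} = ⊤)
    (f : (V × T) →ₗ[K] (V' × T')) (hf : ∀ u v, (f (0, s u v)).1 = 0) (w : T) :
    (f (0, w)).1 = 0 := by
  have h : LinearMap.fst K V' T' ∘ₗ f ∘ₗ LinearMap.inr K V T = 0 := by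
    refine LinearMap.ext_on hs ?_
    rintro _ ⟨u, v, rfl⟩
    exact hf u v
  exact LinearMap.congr_fun h w

/-- If `f ∘ g = id` and `f` maps `0 × T'` into `0 × T`, then the maps induced by `f` and `g` on the
first factors also compose to the identity. -/
theorem fst_map_fst_map_inl {K V T V' T' : Type*} [Field K]
    [AddCommGroup V] [Module K V] [AddCommGroup T] [Module K T]
    [AddCommGroup V'] [Module K V'] [AddCommGroup T'] [Module K T']
    (f : (V' × T') →ₗ[K] (V × T)) (g : (V × T) →ₗ[K] (V' × T'))
    (hfg : ∀ x, f (g x) = x) (hf : ∀ w, (f (0, w)).1 = 0) (v : V) :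
    (f ((g (v, 0)).1, 0)).1 = v := by
  have h : f ((g (v, 0)).1, 0) + f (0, (g (v, 0)).2) = (v, 0) := by
    rw [← map_add, Prod.mk_add_mk, add_zero, zero_add]
    exact hfg (v, 0)
  simpa [hf] using congrArg Prod.fst h

/-- If `f ∘ g = id` and `g` maps `0 × T` into `0 × T'`, then the restrictions of `f` and `g` to the
second factors also compose to the identity. -/
theorem snd_map_snd_map_inr {K V T V' T' : Type*} [Field K]
    [AddCommGroup V] [Module K V] [AddCommGroup T] [Module K T]
    [AddCommGroup V'] [Module K V'] [AddCommGroup T'] [Module K T']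
    (f : (V' × T') →ₗ[K] (V × T)) (g : (V × T) →ₗ[K] (V' × T'))
    (hfg : ∀ x, f (g x) = x) (hg : ∀ w, (g (0, w)).1 = 0) (w : T) :
    (f (0, (g (0, w)).2)).2 = w := by
  have h : ((0 : V'), (g (0, w)).2) = g (0, w) := Prod.ext (hg w).symm rfl
  rw [h, hfg]


/-- Let `K` be a field of characteristic `p > 2` and let
`s : V × V → T` and `t : V' × V' → T'` be alternating, full `K`-tensors. Then the `K`-Lie
algebras `L_s(K)` and `L_t(K)` (i.e. `V ⊕ T` with bracket `[(v,w),(v',w')] = (0, s(v,v'))`,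
and likewise for `t`) are isomorphic if and only if `s` and `t` are `K`-pseudo-isometric.
A Lie algebra isomorphism is encoded as a `K`-linear equivalence preserving the brackets. -/
theorem statement3 {K : Type*} [Field K] (p : ℕ) [CharP K p] (hp : 2 < p)
    {V T V' T' : Type*}
    [AddCommGroup V] [Module K V] [FiniteDimensional K V]
    [AddCommGroup T] [Module K T] [FiniteDimensional K T]
    [AddCommGroup V'] [Module K V'] [FiniteDimensional K V']
    [AddCommGroup T'] [Module K T'] [FiniteDimensional K T']
    (s : V →ₗ[K] V →ₗ[K] T) (t : V' →ₗ[K] V' →ₗ[K] T')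
    (hsalt : ∀ v, s v v = 0) (htalt : ∀ v, t v v = 0)
    (hsfull : Submodule.span K {w | ∃ u v, s u v = w} = ⊤)
    (htfull : Submodule.span K {w | ∃ u v, t u v = w} = ⊤) :
    (∃ e : (V × T) ≃ₗ[K] (V' × T'),
        ∀ x y : V × T, e (0, s x.1 y.1) = ((0 : V'), t (e x).1 (e y).1)) ↔
    (∃ α : V ≃ₗ[K] V', ∃ β : T ≃ₗ[K] T', ∀ u v, t (α u) (α v) = β (s u v)) := by
  constructor
  · rintro ⟨e, he⟩
    have hsymm : ∀ u v, e.symm (0, t u v) = (0, s (e.symm (u, 0)).1 (e.symm (v, 0)).1) := by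
      intro u v
      rw [LinearEquiv.symm_apply_eq, he]
      simp
    have h₁ : ∀ w, (e (0, w)).1 = 0 :=
      fst_map_inr_eq_zero_of_full s hsfull e.toLinearMap
        fun u v => congrArg Prod.fst (he (u, 0) (v, 0))
    have h₂ : ∀ w, (e.symm (0, w)).1 = 0 :=
      fst_map_inr_eq_zero_of_full t htfull e.symm.toLinearMap
        fun u v => congrArg Prod.fst (hsymm u v)
    let α : V ≃ₗ[K] V' := LinearEquiv.ofLinearMap
      (LinearMap.fst K V' T' ∘ₗ e.toLinearMap ∘ₗ LinearMap.inl K V T)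
      (LinearMap.fst K V T ∘ₗ e.symm.toLinearMap ∘ₗ LinearMap.inl K V' T')
      (LinearMap.ext <| fst_map_fst_map_inl e.toLinearMap e.symm.toLinearMap
        e.apply_symm_apply h₁)
      (LinearMap.ext <| fst_map_fst_map_inl e.symm.toLinearMap e.toLinearMap
        e.symm_apply_apply h₂)
    let β : T ≃ₗ[K] T' := LinearEquiv.ofLinearMap
      (LinearMap.snd K V' T' ∘ₗ e.toLinearMap ∘ₗ LinearMap.inr K V T)
      (LinearMap.snd K V T ∘ₗ e.symm.toLinearMap ∘ₗ LinearMap.inr K V' T')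
      (LinearMap.ext <| snd_map_snd_map_inr e.toLinearMap e.symm.toLinearMap
        e.apply_symm_apply h₂)
      (LinearMap.ext <| snd_map_snd_map_inr e.symm.toLinearMap e.toLinearMap
        e.symm_apply_apply h₁)
    exact ⟨α, β, fun u v => (congrArg Prod.snd (he (u, 0) (v, 0))).symm⟩
  · rintro ⟨α, β, h⟩
    exact ⟨α.prodCongr β, fun x y => by simp [h]⟩
end

section
/- Let K be a field of characteristic p > 2 and let s : V × V → T and t : V' × V' → T' be alternating, full K-tensors. Then the Baer groups G_s(K) and G_t(K) are isomorphic as abstract groups if and only if s and t are F_p-pseudo-isometric, where F_p is the prime subfield of K. -/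
section BaerHom

variable {K V T V' T' : Type*} [Field K]
  [AddCommGroup V] [Module K V] [AddCommGroup T] [Module K T]
  [AddCommGroup V'] [Module K V'] [AddCommGroup T'] [Module K T']
  {s : V →ₗ[K] V →ₗ[K] T} {t : V' →ₗ[K] V' →ₗ[K] T'} {f : V × T → V' × T'}

/-- A map of Baer groups sends the commutator `(0, s u v)` to the commutator of the images. -/
theorem baerHom_commutator (h2 : (2 : K) ≠ 0)
    (hsalt : ∀ v, s v v = 0) (htalt : ∀ v, t v v = 0)
    (hf : ∀ x y, f (baerMul (K := K) (fun u v => s u v) x y) =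
      baerMul (K := K) (fun u v => t u v) (f x) (f y)) (x y : V × T) :
    f (0, s x.1 y.1) = (0, t (f x).1 (f y).1) := by
  have half (w : T) : (2 : K)⁻¹ • w + (2 : K)⁻¹ • w = w := by
    rw [← add_smul, ← two_mul, mul_inv_cancel₀ h2, one_smul]
  have half' (w : T') : (2 : K)⁻¹ • w + (2 : K)⁻¹ • w = w := by
    rw [← add_smul, ← two_mul, mul_inv_cancel₀ h2, one_smul]
  have hs : s y.1 x.1 = -s x.1 y.1 := (LinearMap.IsAlt.neg hsalt x.1 y.1).symm
  have ht : t (f y).1 (f x).1 = -t (f x).1 (f y).1 := (LinearMap.IsAlt.neg htalt _ _).symm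
  have key : baerMul (K := K) (fun u v => s u v)
      (baerMul (K := K) (fun u v => s u v) y x) (0, s x.1 y.1) =
      baerMul (K := K) (fun u v => s u v) x y := by
    ext
    · simp [baerMul, add_comm]
    · simp only [baerMul, map_zero, smul_zero, add_zero, hs, smul_neg]
      nth_rewrite 2 [← half (s x.1 y.1)]
      abel
  have h := congrArg f key
  rw [hf, hf, hf] at h
  have h₁ : (f (0, s x.1 y.1)).1 = 0 := by
    have := congrArg Prod.fst h
    simp only [baerMul] at this
    rwa [add_comm (f x).1, add_eq_left] at this
  refine Prod.ext h₁ ?_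
  have h₂ := congrArg Prod.snd h
  simp only [baerMul, h₁, map_zero, smul_zero, add_zero, ht, smul_neg] at h₂
  change (f (0, s x.1 y.1)).2 = t (f x).1 (f y).1
  rw [← half' (t (f x).1 (f y).1), ← sub_eq_zero]
  rw [← sub_eq_zero] at h₂
  rw [← h₂]
  abel

/-- If `s` is full, a map of Baer groups sends the derived subgroup `0 × T` into `0 × T'`. -/
theorem baerHom_fst_zero (h2 : (2 : K) ≠ 0)
    (hsalt : ∀ v, s v v = 0) (htalt : ∀ v, t v v = 0)
    (hsfull : Submodule.span K {w | ∃ u v, s u v = w} = ⊤)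
    (hf : ∀ x y, f (baerMul (K := K) (fun u v => s u v) x y) =
      baerMul (K := K) (fun u v => t u v) (f x) (f y)) (w : T) :
    (f (0, w)).1 = 0 := by
  have hcomm (u v : V) : (f (0, s u v)).1 = 0 :=
    congrArg Prod.fst (baerHom_commutator h2 hsalt htalt hf (u, 0) (v, 0))
  have hadd (a b : T) : (f (0, a + b)).1 = (f (0, a)).1 + (f (0, b)).1 := by
    simpa [baerMul] using congrArg Prod.fst (hf (0, a) (0, b))
  have hw : w ∈ Submodule.span K {w | ∃ u v, s u v = w} := hsfull ▸ Submodule.mem_top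
  suffices ∀ k : K, (f (0, k • w)).1 = 0 by simpa using this 1
  induction hw using Submodule.span_induction with
  | mem x hx =>
    obtain ⟨u, v, rfl⟩ := hx
    intro k
    simpa using hcomm (k • u) v
  | zero =>
    intro k
    simpa using hcomm 0 0
  | add a b _ _ ha hb =>
    intro k
    rw [smul_add, hadd, ha, hb, add_zero]
  | smul c a _ ha =>
    intro k
    rw [smul_smul]
    exact ha _

/-- If `s` is full, the first component of a map of Baer groups depends only on the first
component of its argument. -/
theorem baerHom_fst (h2 : (2 : K) ≠ 0)
    (hsalt : ∀ v, s v v = 0) (htalt : ∀ v, t v v = 0)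
    (hsfull : Submodule.span K {w | ∃ u v, s u v = w} = ⊤)
    (hf : ∀ x y, f (baerMul (K := K) (fun u v => s u v) x y) =
      baerMul (K := K) (fun u v => t u v) (f x) (f y)) (v : V) (w : T) :
    (f (v, w)).1 = (f (v, 0)).1 := by
  have h := congrArg Prod.fst (hf (v, 0) (0, w))
  simpa [baerMul, baerHom_fst_zero h2 hsalt htalt hsfull hf w] using h

/-- An isomorphism of Baer groups of full alternating tensors induces a pseudo-isometry. -/
theorem exists_pseudoIsometry_of_baerEquiv (h2 : (2 : K) ≠ 0)
    (hsalt : ∀ v, s v v = 0) (htalt : ∀ v, t v v = 0)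
    (hsfull : Submodule.span K {w | ∃ u v, s u v = w} = ⊤)
    (htfull : Submodule.span K {w | ∃ u v, t u v = w} = ⊤)
    (e : (V × T) ≃ (V' × T'))
    (he : ∀ x y, e (baerMul (K := K) (fun u v => s u v) x y) =
      baerMul (K := K) (fun u v => t u v) (e x) (e y)) :
    ∃ α : V ≃+ V', ∃ β : T ≃+ T', ∀ u v, t (α u) (α v) = β (s u v) := by
  have he' (x y : V' × T') : e.symm (baerMul (K := K) (fun u v => t u v) x y) =
      baerMul (K := K) (fun u v => s u v) (e.symm x) (e.symm y) := by
    rw [Equiv.symm_apply_eq, he, e.apply_symm_apply, e.apply_symm_apply]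
  have hz := baerHom_fst_zero h2 hsalt htalt hsfull he
  have hz' := baerHom_fst_zero h2 htalt hsalt htfull he'
  have h₁ := baerHom_fst h2 hsalt htalt hsfull he
  have h₁' := baerHom_fst h2 htalt hsalt htfull he'
  let α : V ≃+ V' :=
    { toFun v := (e (v, 0)).1
      invFun v := (e.symm (v, 0)).1
      left_inv v := by
        beta_reduce
        rw [← h₁' _ (e (v, 0)).2, Prod.mk.eta, e.symm_apply_apply]
      right_inv v := by
        beta_reduce
        rw [← h₁ _ (e.symm (v, 0)).2, Prod.mk.eta, e.apply_symm_apply]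
      map_add' u v := by
        have h := congrArg Prod.fst (he (u, 0) (v, 0))
        simp only [baerMul] at h
        rwa [h₁] at h }
  let β : T ≃+ T' :=
    { toFun w := (e (0, w)).2
      invFun w := (e.symm (0, w)).2
      left_inv w := by
        have h : (0, (e (0, w)).2) = e (0, w) := Prod.ext (hz w).symm rfl
        simp only [h, e.symm_apply_apply]
      right_inv w := by
        have h : (0, (e.symm (0, w)).2) = e.symm (0, w) := Prod.ext (hz' w).symm rfl
        simp only [h, e.apply_symm_apply]
      map_add' a b := by
        simpa [baerMul, hz] using congrArg Prod.snd (he (0, a) (0, b)) }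
  exact ⟨α, β, fun u v =>
    (congrArg Prod.snd (baerHom_commutator h2 hsalt htalt he (u, 0) (v, 0))).symm⟩

/-- The product of the two components of a pseudo-isometry is multiplicative. -/
theorem map_baerMul_of_pseudoIsometry (h2 : (2 : K) ≠ 0) (α : V ≃+ V') (β : T ≃+ T')
    (h : ∀ u v, t (α u) (α v) = β (s u v)) (x y : V × T) :
    α.toEquiv.prodCongr β.toEquiv (baerMul (K := K) (fun u v => s u v) x y) =
      baerMul (K := K) (fun u v => t u v)
        (α.toEquiv.prodCongr β.toEquiv x) (α.toEquiv.prodCongr β.toEquiv y) := by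
  have hhalf (w : T) : β ((2 : K)⁻¹ • w) = (2 : K)⁻¹ • β w := by
    rw [eq_inv_smul_iff₀ h2, two_smul, ← map_add, ← two_smul K, smul_inv_smul₀ h2]
  simp [baerMul, h, hhalf]

end BaerHom

/-- Let `K` be a field of characteristic `p > 2` and let `s : V × V → T` and
`t : V' × V' → T'` be alternating, full `K`-tensors. Then the Baer groups `G_s(K)` and
`G_t(K)` are isomorphic as abstract groups if and only if `s` and `t` are
`F_p`-pseudo-isometric.  Since `char K = p > 0`, a map between `K`-vector spaces is
`F_p`-linear precisely when it is additive, so an `F_p`-pseudo-isometry is encoded as a pair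
of additive equivalences `(α, β)` with `t(α(u), α(v)) = β(s(u,v))`. -/
theorem statement4 {K : Type*} [Field K] (p : ℕ) [CharP K p] (hp : 2 < p)
    {V T V' T' : Type*}
    [AddCommGroup V] [Module K V] [FiniteDimensional K V]
    [AddCommGroup T] [Module K T] [FiniteDimensional K T]
    [AddCommGroup V'] [Module K V'] [FiniteDimensional K V']
    [AddCommGroup T'] [Module K T'] [FiniteDimensional K T']
    (s : V →ₗ[K] V →ₗ[K] T) (t : V' →ₗ[K] V' →ₗ[K] T')
    (hsalt : ∀ v, s v v = 0) (htalt : ∀ v, t v v = 0)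
    (hsfull : Submodule.span K {w | ∃ u v, s u v = w} = ⊤)
    (htfull : Submodule.span K {w | ∃ u v, t u v = w} = ⊤) :
    (∃ e : (V × T) ≃ (V' × T'),
        ∀ x y, e (baerMul (K := K) (fun u v => s u v) x y) =
          baerMul (K := K) (fun u v => t u v) (e x) (e y)) ↔
    (∃ α : V ≃+ V', ∃ β : T ≃+ T', ∀ u v, t (α u) (α v) = β (s u v)) := by
  have h2 : (2 : K) ≠ 0 := Ring.two_ne_zero (by rw [ringChar.eq K p]; omega)
  constructor
  · rintro ⟨e, he⟩
    exact exists_pseudoIsometry_of_baerEquiv h2 hsalt htalt hsfull htfull e he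
  · rintro ⟨α, β, h⟩
    exact ⟨_, map_baerMul_of_pseudoIsometry h2 α β h⟩
end

section
/- Let K be a field and let t : U × W → T be a fully nondegenerate K-tensor. Then the centroid Cent(t) is a commutative K-algebra. -/
/-- Let `K` be a field and `t : U × W → T` a fully nondegenerate `K`-tensor.
Then the centroid `Cent(t)` — the `K`-algebra of triples `(α, β, γ)` with
`t(α(u), w) = t(u, β(w)) = γ(t(u,w))` for all `u, w` — is commutative: any two of its
elements commute componentwise. -/
theorem statement6 {K U W T : Type*} [Field K]
    [AddCommGroup U] [Module K U] [FiniteDimensional K U]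
    [AddCommGroup W] [Module K W] [FiniteDimensional K W]
    [AddCommGroup T] [Module K T] [FiniteDimensional K T]
    (t : U →ₗ[K] W →ₗ[K] T)
    (hnd₁ : ∀ u, (∀ w, t u w = 0) → u = 0)
    (hnd₂ : ∀ w, (∀ u, t u w = 0) → w = 0)
    (hfull : Submodule.span K {x | ∃ u w, t u w = x} = ⊤) :
    ∀ c c' : (U →ₗ[K] U) × (W →ₗ[K] W) × (T →ₗ[K] T),
      (∀ u w, t (c.1 u) w = t u (c.2.1 w) ∧ t (c.1 u) w = c.2.2 (t u w)) →
      (∀ u w, t (c'.1 u) w = t u (c'.2.1 w) ∧ t (c'.1 u) w = c'.2.2 (t u w)) →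
      c.1 ∘ₗ c'.1 = c'.1 ∘ₗ c.1 ∧ c.2.1 ∘ₗ c'.2.1 = c'.2.1 ∘ₗ c.2.1 ∧
        c.2.2 ∘ₗ c'.2.2 = c'.2.2 ∘ₗ c.2.2 := by
  rintro ⟨α, β, γ⟩ ⟨α', β', γ'⟩ h h'
  dsimp only at h h' ⊢
  have hcomm : ∀ u w, γ (γ' (t u w)) = γ' (γ (t u w)) := fun u w => by
    rw [← (h' u w).2, (h' u w).1, ← (h u (β' w)).2, ← (h' (α u) w).1, (h' (α u) w).2,
      (h u w).2]
  refine ⟨LinearMap.ext fun u => ?_, LinearMap.ext fun w => ?_, ?_⟩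
  · refine sub_eq_zero.mp (hnd₁ _ fun w => ?_)
    rw [map_sub, LinearMap.sub_apply, LinearMap.comp_apply, LinearMap.comp_apply,
      (h (α' u) w).2, (h' u w).2, (h' (α u) w).2, (h u w).2, hcomm, sub_self]
  · refine sub_eq_zero.mp (hnd₂ _ fun u => ?_)
    rw [map_sub, LinearMap.comp_apply, LinearMap.comp_apply,
      ← (h u (β' w)).1, (h u (β' w)).2, ← (h' u w).1, (h' u w).2,
      ← (h' u (β w)).1, (h' u (β w)).2, ← (h u w).1, (h u w).2, hcomm, sub_self]
  · refine LinearMap.ext_on hfull ?_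
    rintro _ ⟨u, w, rfl⟩
    exact hcomm u w
end
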